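/- arXiv:math/0010314 — 3 statements merged into one kernel-verified Lean document; each statement's English description precedes it below -/
import Mathlib

section
/- (Parametrix construction for elliptic pseudodifferential operators, abstract form.) Suppose P ∈ Ψ m is elliptic, i.e., there exist a ∈ S m representing σ_m(P) and b ∈ S (−m) with a*b − 1 ∈ S (−1) and b*a − 1 ∈ S (−1). Then for every natural number k there exists Q ∈ Ψ (−m) with 1 − P*Q ∈ Ψ (−k) and 1 − Q*P ∈ Ψ (−k); i.e., P has a two-sided parametrix of every order. -/
/-- If the symbols of `P` and `Q` have representatives `a` and `b` whose product is `1` modulo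
lower order, then `1 - P * Q` is of order `-1`. -/
theorem one_sub_mul_mem_of_symbol_mul_eq_one
    {A S : Type*} [Ring A] [Ring S] {Ψ : ℤ → AddSubgroup A} {SΨ : ℤ → AddSubgroup S}
    (hΨmul : ∀ m l : ℤ, ∀ P Q : A, P ∈ Ψ m → Q ∈ Ψ l → P * Q ∈ Ψ (m + l))
    (hΨone : (1 : A) ∈ Ψ 0)
    (hSmul : ∀ m l : ℤ, ∀ a b : S, a ∈ SΨ m → b ∈ SΨ l → a * b ∈ SΨ (m + l))
    {σ : ℤ → A → S}
    (hσmem : ∀ m : ℤ, ∀ P ∈ Ψ m, σ m P ∈ SΨ m)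
    (hσadd : ∀ m : ℤ, ∀ P ∈ Ψ m, ∀ Q ∈ Ψ m, σ m (P + Q) - σ m P - σ m Q ∈ SΨ (m - 1))
    (hE2 : ∀ m : ℤ, ∀ P ∈ Ψ m, (σ m P ∈ SΨ (m - 1) ↔ P ∈ Ψ (m - 1)))
    (hσmul : ∀ m l : ℤ, ∀ P ∈ Ψ m, ∀ Q ∈ Ψ l,
      σ (m + l) (P * Q) - σ m P * σ l Q ∈ SΨ (m + l - 1))
    (hσone : σ 0 1 - 1 ∈ SΨ (-1))
    {m l : ℤ} (hml : m + l = 0) {P Q : A} (hP : P ∈ Ψ m) (hQ : Q ∈ Ψ l)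
    {a b : S} (ha : a ∈ SΨ m) (hPa : σ m P - a ∈ SΨ (m - 1)) (hQb : σ l Q - b ∈ SΨ (l - 1))
    (hab : a * b - 1 ∈ SΨ (-1)) :
    1 - P * Q ∈ Ψ (-1) := by
  have hPQ : P * Q ∈ Ψ 0 := hml ▸ hΨmul m l P Q hP hQ
  have hR : 1 - P * Q ∈ Ψ 0 := sub_mem hΨone hPQ
  have hadd := hσadd 0 _ hR _ hPQ
  have hmul := hσmul m l P hP Q hQ
  have hleft := hSmul _ _ _ _ hPa (hσmem l Q hQ)
  have hright := hSmul _ _ _ _ ha hQb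
  rw [show m - 1 + l = -1 by lia] at hleft
  rw [show m + (l - 1) = -1 by lia] at hright
  rw [hml, zero_sub] at hmul
  rw [sub_add_cancel, zero_sub] at hadd
  have hsymbol : σ 0 (1 - P * Q) ∈ SΨ (-1) := by
    convert sub_mem hσone
      (add_mem hadd (add_mem hmul (add_mem hleft (add_mem hright hab)))) using 1
    noncomm_ring
  exact (hE2 0 _ hR).1 hsymbol


/-- **Parametrix construction for elliptic pseudodifferential operators (abstract form).**
`A` is a filtered ring of "operators", `S` a filtered ring of "symbols", and for every
`m : ℤ` the map `σ m : Ψ m → S m / S (m-1)` is encoded by a representative-choice function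
`σ : ℤ → A → S`, where `a ∈ S m` represents `σ_m P` iff `σ m P - a ∈ S (m-1)`.
If `P ∈ Ψ m` is elliptic (its symbol has an inverse modulo lower order), then `P`
has a two-sided parametrix of every order `k`. -/
theorem elliptic_has_parametrix
    {A S : Type*} [Ring A] [Ring S]
    (Ψ : ℤ → AddSubgroup A) (SΨ : ℤ → AddSubgroup S)
    -- filtration axioms for Ψ
    (hΨmono : ∀ m m' : ℤ, m ≤ m' → Ψ m ≤ Ψ m')
    (hΨmul : ∀ m l : ℤ, ∀ P Q : A, P ∈ Ψ m → Q ∈ Ψ l → P * Q ∈ Ψ (m + l))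
    (hΨone : (1 : A) ∈ Ψ 0)
    -- filtration axioms for SΨ
    (hSmono : ∀ m m' : ℤ, m ≤ m' → SΨ m ≤ SΨ m')
    (hSmul : ∀ m l : ℤ, ∀ a b : S, a ∈ SΨ m → b ∈ SΨ l → a * b ∈ SΨ (m + l))
    (hSone : (1 : S) ∈ SΨ 0)
    -- the symbol maps, given by representatives
    (σ : ℤ → A → S)
    (hσmem : ∀ m : ℤ, ∀ P ∈ Ψ m, σ m P ∈ SΨ m)
    -- additivity of σ_m (as a map into the quotient S m / S (m-1))
    (hσadd : ∀ m : ℤ, ∀ P ∈ Ψ m, ∀ Q ∈ Ψ m, σ m (P + Q) - σ m P - σ m Q ∈ SΨ (m - 1))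
    -- (E1) surjectivity of σ_m
    (hE1 : ∀ m : ℤ, ∀ a ∈ SΨ m, ∃ P ∈ Ψ m, σ m P - a ∈ SΨ (m - 1))
    -- (E2) σ_m P = 0 in the quotient iff P ∈ Ψ (m-1)
    (hE2 : ∀ m : ℤ, ∀ P ∈ Ψ m, (σ m P ∈ SΨ (m - 1) ↔ P ∈ Ψ (m - 1)))
    -- multiplicativity: representatives multiply to a representative
    (hσmul : ∀ m l : ℤ, ∀ P ∈ Ψ m, ∀ Q ∈ Ψ l,
      σ (m + l) (P * Q) - σ m P * σ l Q ∈ SΨ (m + l - 1))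
    -- 1_S represents σ_0 (1_A)
    (hσone : σ 0 1 - 1 ∈ SΨ (-1))
    -- the elliptic operator
    (m : ℤ) (P : A) (hP : P ∈ Ψ m)
    (hell : ∃ a ∈ SΨ m, σ m P - a ∈ SΨ (m - 1) ∧
      ∃ b ∈ SΨ (-m), a * b - 1 ∈ SΨ (-1) ∧ b * a - 1 ∈ SΨ (-1)) :
    ∀ k : ℕ, ∃ Q ∈ Ψ (-m), 1 - P * Q ∈ Ψ (-(k : ℤ)) ∧ 1 - Q * P ∈ Ψ (-(k : ℤ)) := by
  obtain ⟨a, ha, hPa, b, hb, hab, hba⟩ := hell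
  obtain ⟨Q₀, hQ₀, hQ₀b⟩ := hE1 (-m) b hb
  have hright : 1 - P * Q₀ ∈ Ψ (-1) :=
    one_sub_mul_mem_of_symbol_mul_eq_one hΨmul hΨone hSmul hσmem hσadd hE2 hσmul hσone
      (add_neg_cancel m) hP hQ₀ ha hPa hQ₀b hab
  have hleft : 1 - Q₀ * P ∈ Ψ (-1) :=
    one_sub_mul_mem_of_symbol_mul_eq_one hΨmul hΨone hSmul hσmem hσadd hE2 hσmul hσone
      (neg_add_cancel m) hQ₀ hP hb hQ₀b hPa hba
  intro k
  induction k with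
  | zero =>
    exact ⟨Q₀, hQ₀, hΨmono _ _ (by simp) hright, hΨmono _ _ (by simp) hleft⟩
  | succ k ih =>
    obtain ⟨Q, hQ, hPQ, hQP⟩ := ih
    have hQPQ₀ := hΨmul _ _ _ _ (hΨmul _ _ _ _ hQ hP) hQ₀
    rw [neg_add_cancel, zero_add] at hQPQ₀
    rw [show (-((k + 1 : ℕ) : ℤ)) = -(k : ℤ) + -1 by push_cast; ring]
    refine ⟨Q + Q₀ - Q * P * Q₀, sub_mem (add_mem hQ hQ₀) hQPQ₀, ?_, ?_⟩
    · convert hΨmul _ _ _ _ hPQ hright using 1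
      noncomm_ring
    · convert hΨmul _ _ _ _ hQP hleft using 1
      noncomm_ring
end

section
/- (Seeley's characterization of smoothness up to the boundary, one-dimensional case.) Let u : (0,∞) → ℝ be infinitely differentiable. Then there exists an infinitely differentiable function g : ℝ → ℝ with g(x) = u(x) for all x > 0 if and only if for every natural number k and every B > 0 the k-th derivative of u is bounded on (0, B). -/
/-- A smooth function with a single prescribed nonzero derivative `a` at the origin, of order `n`,
whose derivatives are all bounded, those of order less than `n` by `δ`. -/
theorem exists_contDiff_iteratedDeriv_zero_eq_ite (n : ℕ) (a : ℝ) {δ : ℝ} (hδ : 0 < δ) :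
    ∃ f : ℝ → ℝ, ContDiff ℝ (⊤ : ℕ∞) f ∧
      (∀ k, ∃ C, ∀ x, ‖iteratedDeriv k f x‖ ≤ C) ∧
      (∀ k < n, ∀ x, ‖iteratedDeriv k f x‖ ≤ δ) ∧
      ∀ k, iteratedDeriv k f 0 = if k = n then a else 0 := by
  let φ : ContDiffBump (0 : ℝ) := ⟨1, 2, by norm_num, by norm_num⟩
  let ψ : ℝ → ℝ := fun y => y ^ n * φ y
  have hψ : ContDiff ℝ (⊤ : ℕ∞) ψ := (contDiff_id.pow n).mul φ.contDiff
  have hsupp : HasCompactSupport ψ := φ.hasCompactSupport.mul_left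
  have hbound : ∀ k, ∃ C, ∀ x, ‖iteratedDeriv k ψ x‖ ≤ C := fun k => by
    obtain ⟨C, hC⟩ := (hsupp.iteratedFDeriv (𝕜 := ℝ) k).exists_bound_of_continuous
      (hψ.continuous_iteratedFDeriv (by exact_mod_cast le_top))
    exact ⟨C, fun x => norm_iteratedFDeriv_eq_norm_iteratedDeriv.symm.trans_le (hC x)⟩
  choose C hC using hbound
  have hC0 : ∀ k, 0 ≤ C k := fun k => (norm_nonneg _).trans (hC k 0)
  have hψ0 : ∀ k, iteratedDeriv k ψ 0 = if k = n then (n.factorial : ℝ) else 0 := fun k => by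
    have h : ψ =ᶠ[nhds 0] fun y => y ^ n := by
      filter_upwards [φ.eventuallyEq_one] with y hy
      simp [ψ, hy]
    rw [h.iteratedDeriv_eq, iteratedDeriv_fun_pow_zero]
    split_ifs <;> simp
  set c : ℝ := a / n.factorial with hc
  set S : ℝ := ∑ k ∈ Finset.range n, C k
  have hS : 0 ≤ S := Finset.sum_nonneg fun k _ => hC0 k
  set R : ℝ := 1 + |c| * S / δ with hR
  have hR1 : 1 ≤ R := by
    have : 0 ≤ |c| * S / δ := by positivity
    linarith
  have hR0 : 0 < R := by linarith
  have hRS : |c| * S ≤ δ * R := by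
    have : δ * R = δ + |c| * S := by rw [hR]; field_simp
    linarith
  have hcomp : ContDiff ℝ (⊤ : ℕ∞) fun x => ψ (R * x) := hψ.comp (contDiff_const.mul contDiff_id)
  have hderiv : ∀ k x, iteratedDeriv k (fun x => c / R ^ n * ψ (R * x)) x =
      c / R ^ n * (R ^ k * iteratedDeriv k ψ (R * x)) := fun k x => by
    rw [iteratedDeriv_const_mul_field,
      iteratedDeriv_comp_const_mul (hψ.of_le (by exact_mod_cast le_top))]
  have hnorm : ∀ k x, ‖iteratedDeriv k (fun x => c / R ^ n * ψ (R * x)) x‖ ≤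
      |c| / R ^ n * (R ^ k * C k) := fun k x => by
    rw [hderiv, norm_mul, norm_mul, norm_div, norm_pow, norm_pow, Real.norm_eq_abs c,
      Real.norm_of_nonneg hR0.le]
    gcongr
    exact hC k _
  refine ⟨fun x => c / R ^ n * ψ (R * x), contDiff_const.mul hcomp, fun k => ⟨_, hnorm k⟩,
    fun k hk x => (hnorm k x).trans ?_, fun k => ?_⟩
  · have hpow : R ^ k * R ≤ R ^ n := by
      rw [← pow_succ]
      exact pow_le_pow_right₀ hR1 hk
    have hCS : C k ≤ S := Finset.single_le_sum (fun i _ => hC0 i) (Finset.mem_range.2 hk)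
    rw [div_mul_eq_mul_div, div_le_iff₀ (by positivity)]
    calc |c| * (R ^ k * C k) ≤ |c| * (R ^ k * S) := by gcongr
      _ = R ^ k * (|c| * S) := by ring
      _ ≤ R ^ k * (δ * R) := by gcongr
      _ = δ * (R ^ k * R) := by ring
      _ ≤ δ * R ^ n := by gcongr
  · rw [hderiv, mul_zero, hψ0]
    split_ifs with h
    · subst h
      rw [hc]
      field_simp
    · simp

/-- **Borel's lemma**: every real sequence is the sequence of derivatives at the origin of a
smooth function. -/
theorem exists_contDiff_iteratedDeriv_zero_eq (a : ℕ → ℝ) :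
    ∃ G : ℝ → ℝ, ContDiff ℝ (⊤ : ℕ∞) G ∧ ∀ k, iteratedDeriv k G 0 = a k := by
  choose f hf hbound hsmall hzero using fun n =>
    exists_contDiff_iteratedDeriv_zero_eq_ite n (a n) (δ := (1 / 2 : ℝ) ^ n) (by positivity)
  choose C hC using hbound
  let v : ℕ → ℕ → ℝ := fun k n => if k < n then (1 / 2 : ℝ) ^ n else C n k
  have hv : ∀ k : ℕ, (k : ℕ∞) ≤ (⊤ : ℕ∞) → Summable (v k) := fun k _ => by
    refine summable_geometric_two.congr_cofinite ?_
    rw [Nat.cofinite_eq_atTop]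
    filter_upwards [Filter.eventually_gt_atTop k] with n hn
    simp [v, hn]
  have hfv : ∀ (k n : ℕ) (x : ℝ), (k : ℕ∞) ≤ (⊤ : ℕ∞) →
      ‖iteratedFDeriv ℝ k (f n) x‖ ≤ v k n := fun k n x _ => by
    rw [norm_iteratedFDeriv_eq_norm_iteratedDeriv]
    by_cases h : k < n
    · simpa only [v, h, if_true] using hsmall n k h x
    · simpa only [v, h, if_false] using hC n k x
  refine ⟨fun x => ∑' n, f n x, contDiff_tsum hf hv hfv, fun k => ?_⟩
  have hsum : Summable fun n => iteratedFDeriv ℝ k (f n) 0 :=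
    (hv k le_top).of_norm_bounded fun n => hfv k n 0 le_top
  rw [iteratedDeriv_eq_iteratedFDeriv, iteratedFDeriv_tsum hf hv hfv le_top,
    ContinuousMultilinearMap.tsum_eval hsum]
  simp only [← iteratedDeriv_eq_iteratedFDeriv, hzero]
  exact tsum_ite_eq' k a

/-- In a sequence of functions in which each term has the next one as derivative, the first term
is smooth. -/
theorem contDiff_of_forall_hasDerivAt_succ {h : ℕ → ℝ → ℝ}
    (hh : ∀ k x, HasDerivAt (h k) (h (k + 1) x) x) : ContDiff ℝ (⊤ : ℕ∞) (h 0) := by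
  have hiter : ∀ k, iteratedDeriv k (h 0) = h k := fun k => by
    induction k with
    | zero => simp
    | succ k ih =>
      rw [iteratedDeriv_succ, ih]
      exact funext fun x => (hh k x).deriv
  refine contDiff_of_differentiable_iteratedDeriv fun k _ => ?_
  rw [hiter]
  exact fun x => (hh k x).differentiableAt

/-- A function with bounded derivative on `(0, 1)` has a limit at `0` from the right. -/
theorem exists_tendsto_nhdsGT_zero_of_hasDerivAt_bounded {f f' : ℝ → ℝ} {M : ℝ}
    (hf : ∀ x ∈ Set.Ioo (0 : ℝ) 1, HasDerivAt f (f' x) x)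
    (hM : ∀ x ∈ Set.Ioo (0 : ℝ) 1, |f' x| ≤ M) :
    ∃ L, Filter.Tendsto f (nhdsWithin 0 (Set.Ioi 0)) (nhds L) := by
  have hlip : LipschitzOnWith M.toNNReal f (Set.Ioo 0 1) :=
    (convex_Ioo 0 1).lipschitzOnWith_of_nnnorm_hasDerivWithin_le
      (fun x hx => (hf x hx).hasDerivWithinAt) fun x hx => by
        rw [← NNReal.coe_le_coe, coe_nnnorm, Real.norm_eq_abs]
        exact (hM x hx).trans (Real.le_coe_toNNReal M)
  obtain ⟨g, hg, hfg⟩ := hlip.extend_real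
  refine ⟨g 0, (hg.continuous.continuousAt.mono_left nhdsWithin_le_nhds).congr' ?_⟩
  filter_upwards [Ioo_mem_nhdsGT (zero_lt_one' ℝ)] with x hx using (hfg hx).symm

/-- **Seeley's characterization of smoothness up to the boundary (1-dimensional case).**
A smooth function `u` on `(0,∞)` extends to a smooth function on `ℝ` iff every derivative
of `u` is bounded on every bounded interval `(0,B)`. -/
theorem seeley_extension_characterization
    (u : ℝ → ℝ) (hu : ContDiffOn ℝ (⊤ : ℕ∞) u (Set.Ioi 0)) :
    (∃ g : ℝ → ℝ, ContDiff ℝ (⊤ : ℕ∞) g ∧ ∀ x : ℝ, 0 < x → g x = u x) ↔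
      ∀ k : ℕ, ∀ B : ℝ, 0 < B → ∃ M : ℝ, ∀ x ∈ Set.Ioo (0 : ℝ) B,
        |iteratedDerivWithin k u (Set.Ioi 0) x| ≤ M := by
  constructor
  · rintro ⟨g, hg, hgu⟩ k B -
    have hcont : Continuous (iteratedDeriv k g) :=
      hg.continuous_iteratedDeriv k (by exact_mod_cast le_top)
    obtain ⟨M, hM⟩ := (isCompact_Icc (a := (0 : ℝ)) (b := B)).exists_bound_of_continuousOn
      hcont.continuousOn
    refine ⟨M, fun x hx => ?_⟩
    have hx0 : x ∈ Set.Ioi (0 : ℝ) := hx.1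
    rw [← iteratedDerivWithin_congr (f := g) (s := Set.Ioi 0) (fun y hy => hgu y hy) hx0,
      iteratedDerivWithin_of_isOpen isOpen_Ioi hx0]
    exact hM x (Set.Ioo_subset_Icc_self hx)
  · intro hb
    set U : ℕ → ℝ → ℝ := fun k => iteratedDerivWithin k u (Set.Ioi 0) with hU
    have hUderiv : ∀ k x, 0 < x → HasDerivAt (U k) (U (k + 1) x) x := fun k x hx => by
      have hd := (hu.differentiableOn_iteratedDerivWithin (m := k)
        (by exact_mod_cast ENat.natCast_lt_top k) (uniqueDiffOn_Ioi 0) x hx).hasDerivWithinAt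
      rw [← iteratedDerivWithin_succ] at hd
      exact hd.hasDerivAt (Ioi_mem_nhds hx)
    have hlim : ∀ k, ∃ L, Filter.Tendsto (U k) (nhdsWithin 0 (Set.Ioi 0)) (nhds L) := fun k => by
      obtain ⟨M, hM⟩ := hb (k + 1) 1 one_pos
      exact exists_tendsto_nhdsGT_zero_of_hasDerivAt_bounded (fun x hx => hUderiv k x hx.1) hM
    choose L hL using hlim
    obtain ⟨G, hG, hGL⟩ := exists_contDiff_iteratedDeriv_zero_eq L
    have hGderiv : ∀ k x, HasDerivAt (iteratedDeriv k G) (iteratedDeriv (k + 1) G x) x :=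
      fun k x => by
        rw [iteratedDeriv_succ]
        exact (hG.differentiable_iteratedDeriv k (by exact_mod_cast ENat.natCast_lt_top k)
          x).hasDerivAt
    let h : ℕ → ℝ → ℝ := fun k x => if 0 < x then U k x else iteratedDeriv k G x
    have hpos : ∀ k x, 0 < x → h k x = U k x := fun k x hx => if_pos hx
    have hnonpos : ∀ k x, x ≤ 0 → h k x = iteratedDeriv k G x := fun k x hx => if_neg hx.not_gt
    have hcont : ∀ k, ContinuousAt (h k) 0 := fun k => by
      rw [continuousAt_iff_continuous_left'_right']
      constructor
      · exact (hGderiv k 0).continuousAt.continuousWithinAt.congr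
          (fun x hx => hnonpos k x (le_of_lt hx)) (hnonpos k 0 le_rfl)
      · rw [ContinuousWithinAt, hnonpos k 0 le_rfl, hGL]
        exact (hL k).congr' (eventually_nhdsWithin_of_forall fun x hx => (hpos k x hx).symm)
    have hderiv : ∀ k x, HasDerivAt (h k) (h (k + 1) x) x := fun k =>
      hasDerivAt_of_hasDerivAt_of_ne' (fun y hy => by
        rcases hy.lt_or_gt with hy | hy
        · rw [hnonpos _ _ hy.le]
          refine (hGderiv k y).congr_of_eventuallyEq ?_
          filter_upwards [Iio_mem_nhds hy] with x hx using hnonpos k x (le_of_lt hx)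
        · rw [hpos _ _ hy]
          refine (hUderiv k y hy).congr_of_eventuallyEq ?_
          filter_upwards [Ioi_mem_nhds hy] with x hx using hpos k x hx)
        (hcont k) (hcont (k + 1))
    exact ⟨h 0, contDiff_of_forall_hasDerivAt_succ hderiv, fun x hx => by simp [hpos 0 x hx, hU]⟩
end

section
/- Let C > 0 and let u : (0,∞)² → ℂ have support contained in {(x,y) : x ≤ C and y ≤ C}. Suppose u is resolved by the blow-up of the corner, i.e., there exist infinitely differentiable functions w₁, w₂ : ℝ² → ℂ with w₁(ξ,η) = u(ξ, ξ·η) and w₂(ξ,η) = u(ξ·η, η) for all ξ, η > 0. Then the push-forward ũ(x) = ∫_0^∞ u(x,y) dy (x > 0) is polyhomogeneous: there exist sequences (a_i)_{i∈ℕ} and (b_i)_{i∈ℕ} of complex numbers such that for every natural number N there is a constant C_N with |ũ(x) − ∑_{i=0}^{N−1} (a_i x^i + b_i x^i log x)| ≤ C_N x^N (1 + |log x|) for all 0 < x ≤ 1. -/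
open MeasureTheory

open Set Filter Topology
open scoped ContDiff

section ParametricIntegral

universe v

/-- Integrals over a compact interval of `C^n` functions are `C^n` in the parameter. -/
theorem contDiff_nat_intervalIntegral {E : Type v} [NormedAddCommGroup E] [NormedSpace ℝ E]
    [ProperSpace E] (a b : ℝ) (n : ℕ) :
    ∀ {V : Type v} [NormedAddCommGroup V] [NormedSpace ℝ V] {f : E × ℝ → V},
      ContDiff ℝ n f → ContDiff ℝ n (fun p => ∫ t in a..b, f (p, t)) := by
  induction n with
  | zero =>
    intro V _ _ f hf
    rw [Nat.cast_zero, contDiff_zero] at hf ⊢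
    exact intervalIntegral.continuous_parametric_intervalIntegral_of_continuous'
      (f := fun p t => f (p, t)) hf a b
  | succ n ih =>
    intro V _ _ f hf
    have hf' : ContDiff ℝ n fun q => (fderiv ℝ f q).comp (ContinuousLinearMap.inl ℝ E ℝ) :=
      (hf.fderiv_right (m := n) (by norm_cast)).clm_comp contDiff_const
    have hd : Differentiable ℝ f := hf.differentiable (by norm_cast)
    push_cast
    rw [contDiff_succ_iff_hasFDerivAt]
    refine ⟨_, ih hf', fun p => ?_⟩
    obtain ⟨M, hM⟩ := ((isCompact_closedBall p 1).prod (isCompact_uIcc (a := a) (b := b))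
      ).exists_bound_of_continuousOn hf'.continuous.continuousOn
    have hc (p : E) : Continuous fun t => f (p, t) := hf.continuous.comp (by fun_prop)
    refine intervalIntegral.hasFDerivAt_integral_of_dominated_of_fderiv_le
      (bound := fun _ => M) (F := fun p t => f (p, t))
      (F' := fun p t => (fderiv ℝ f (p, t)).comp (ContinuousLinearMap.inl ℝ E ℝ))
      (Metric.closedBall_mem_nhds p one_pos)
      (Eventually.of_forall fun q => (hc q).aestronglyMeasurable)
      ((hc p).intervalIntegrable _ _) ?_ ?_ (by simp) ?_
    · exact (hf'.continuous.comp (by fun_prop :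
        Continuous fun t : ℝ => (p, t))).aestronglyMeasurable
    · exact Eventually.of_forall fun t ht q hq => hM (q, t) ⟨hq, uIoc_subset_uIcc ht⟩
    · refine Eventually.of_forall fun t _ q _ => ?_
      exact (hd (q, t)).hasFDerivAt.comp q (hasFDerivAt_prodMk_left q t)

/-- Integrals over a compact interval of smooth functions are smooth in the parameter. -/
theorem contDiff_infty_intervalIntegral {E V : Type v} [NormedAddCommGroup E] [NormedSpace ℝ E]
    [ProperSpace E] [NormedAddCommGroup V] [NormedSpace ℝ V] (a b : ℝ) {f : E × ℝ → V}
    (hf : ContDiff ℝ ∞ f) : ContDiff ℝ ∞ (fun p => ∫ t in a..b, f (p, t)) :=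
  contDiff_infty.2 fun n => contDiff_nat_intervalIntegral a b n (contDiff_infty.1 hf n)

end ParametricIntegral

/-- Hadamard's lemma in the first variable. -/
theorem exists_contDiff_eq_add_fst_mul {F : ℝ × ℝ → ℂ} (hF : ContDiff ℝ ∞ F) :
    ∃ G : ℝ × ℝ → ℂ, ContDiff ℝ ∞ G ∧ ∀ s y : ℝ, F (s, y) = F (0, y) + s * G (s, y) := by
  have hF' : ContDiff ℝ ∞ (fderiv ℝ F) := hF.fderiv_right (by simp)
  have hs : ContDiff ℝ ∞ fun q : (ℝ × ℝ) × ℝ =>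
      fderiv ℝ F (q.2 * q.1.1, q.1.2) ((1 : ℝ), (0 : ℝ)) :=
    (hF'.comp (by fun_prop)).clm_apply contDiff_const
  refine ⟨_, contDiff_infty_intervalIntegral 0 1 hs, fun s y => ?_⟩
  have hd (t : ℝ) : HasDerivAt (fun t : ℝ => F (t * s, y))
      ((s : ℂ) * fderiv ℝ F (t * s, y) (1, 0)) t := by
    have h1 : HasDerivAt (fun t : ℝ => (t * s, y)) ((s, 0) : ℝ × ℝ) t :=
      (by simpa using (hasDerivAt_id t).mul_const s : HasDerivAt (fun t : ℝ => t * s) s t).prodMk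
        (hasDerivAt_const t y)
    have h2 := ((hF.differentiable (by simp)) (t * s, y)).hasFDerivAt.comp_hasDerivAt t h1
    have h3 : ((s, 0) : ℝ × ℝ) = s • ((1, 0) : ℝ × ℝ) := by simp
    rw [h3, map_smul, Complex.real_smul] at h2
    exact h2
  have hcont : Continuous fun t : ℝ => (s : ℂ) * fderiv ℝ F (t * s, y) (1, 0) :=
    continuous_const.mul (hs.continuous.comp (by fun_prop : Continuous fun t : ℝ => ((s, y), t)))
  have := intervalIntegral.integral_eq_sub_of_hasDerivAt (fun t _ => hd t)
    (hcont.intervalIntegrable 0 1)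
  rw [intervalIntegral.integral_const_mul] at this
  simp only [this]
  simp

/-- Hadamard's lemma in the second variable. -/
theorem exists_contDiff_eq_add_snd_mul {F : ℝ × ℝ → ℂ} (hF : ContDiff ℝ ∞ F) :
    ∃ G : ℝ × ℝ → ℂ, ContDiff ℝ ∞ G ∧ ∀ s y : ℝ, F (s, y) = F (s, 0) + y * G (s, y) := by
  obtain ⟨G, hG, h⟩ := exists_contDiff_eq_add_fst_mul
    (hF.comp (contDiff_snd.prodMk contDiff_fst : ContDiff ℝ ∞ fun p : ℝ × ℝ => (p.2, p.1)))
  exact ⟨_, hG.comp (contDiff_snd.prodMk contDiff_fst :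
    ContDiff ℝ ∞ fun p : ℝ × ℝ => (p.2, p.1)), fun s y => h y s⟩

/-- Hadamard's lemma on the line. -/
theorem exists_contDiff_eq_add_mul {S : ℝ → ℂ} (hS : ContDiff ℝ ∞ S) :
    ∃ T : ℝ → ℂ, ContDiff ℝ ∞ T ∧ ∀ x : ℝ, S x = S 0 + x * T x := by
  obtain ⟨G, hG, h⟩ := exists_contDiff_eq_add_fst_mul
    (hS.comp contDiff_fst : ContDiff ℝ ∞ fun p : ℝ × ℝ => S p.1)
  exact ⟨fun x => G (x, 0), hG.comp (by fun_prop), fun x => h x 0⟩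

/-- A smooth function on the line has a smooth primitive. -/
theorem exists_contDiff_primitive {A : ℝ → ℂ} (hA : ContDiff ℝ ∞ A) :
    ∃ P : ℝ → ℂ, ContDiff ℝ ∞ P ∧ ∀ x, HasDerivAt P (A x) x := by
  have h (x : ℝ) : HasDerivAt (fun z => ∫ t in (0 : ℝ)..z, A t) (A x) x :=
    hA.continuous.integral_hasStrictDerivAt 0 x |>.hasDerivAt
  refine ⟨_, contDiff_infty_iff_deriv.2 ⟨fun x => (h x).differentiableAt, ?_⟩, h⟩
  rwa [funext fun x => (h x).deriv]

/-- The functions on `(0, 1]` that are the sum of a smooth function and of the integral over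
`x ≤ y ≤ C` of a smooth function of `(x / y, y)` against `dy / y`. -/
def IsSmoothAddCornerIntegral (C : ℝ) (f : ℝ → ℂ) : Prop :=
  ∃ (S : ℝ → ℂ) (R : ℝ × ℝ → ℂ), ContDiff ℝ ∞ S ∧ ContDiff ℝ ∞ R ∧
    ∀ x : ℝ, 0 < x → x ≤ 1 → f x = S x + ∫ y in x..C, (y : ℂ)⁻¹ * R (x / y, y)

theorem continuousOn_corner_integrand {C x : ℝ} (hx : 0 < x) {R : ℝ × ℝ → ℂ}
    (hR : Continuous R) :
    ContinuousOn (fun y : ℝ => (y : ℂ)⁻¹ * R (x / y, y)) (Icc x C) := by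
  have hne : ∀ y ∈ Icc x C, y ≠ 0 := fun y hy => (hx.trans_le hy.1).ne'
  refine ContinuousOn.mul (ContinuousOn.inv₀ (by fun_prop) fun y hy => ?_)
    (hR.comp_continuousOn ?_)
  · exact_mod_cast hne y hy
  · exact (continuousOn_const.div continuousOn_id hne).prodMk continuousOn_id

theorem IsSmoothAddCornerIntegral.exists_bound {C : ℝ} (hC : 1 ≤ C) {f : ℝ → ℂ}
    (hf : IsSmoothAddCornerIntegral C f) :
    ∃ K : ℝ, ∀ x : ℝ, 0 < x → x ≤ 1 → ‖f x‖ ≤ K * (1 + |Real.log x|) := by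
  obtain ⟨S, R, hS, hR, h⟩ := hf
  obtain ⟨M, hM⟩ := (isCompact_Icc (a := (0 : ℝ)) (b := 1)).exists_bound_of_continuousOn
    hS.continuous.continuousOn
  obtain ⟨L, hL⟩ := ((isCompact_Icc (a := (0 : ℝ)) (b := 1)).prod
    (isCompact_Icc (a := (0 : ℝ)) (b := C))).exists_bound_of_continuousOn
    hR.continuous.continuousOn
  have hM0 : 0 ≤ M := (norm_nonneg _).trans (hM 0 (by simp))
  have hL0 : 0 ≤ L := (norm_nonneg _).trans (hL (0, 0) (by constructor <;> simp; linarith))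
  refine ⟨M + L * (1 + Real.log C), fun x hx hx1 => ?_⟩
  have hxC : x ≤ C := hx1.trans hC
  have hlogC : 0 ≤ Real.log C := Real.log_nonneg hC
  have hI : ‖∫ y in x..C, (y : ℂ)⁻¹ * R (x / y, y)‖ ≤ ∫ y in x..C, L * y⁻¹ := by
    refine intervalIntegral.norm_integral_le_of_norm_le hxC
      (Eventually.of_forall fun y hy => ?_) ?_
    · have hy0 : 0 < y := hx.trans hy.1
      rw [norm_mul, norm_inv, Complex.norm_real, Real.norm_of_nonneg hy0.le, mul_comm]
      refine mul_le_mul_of_nonneg_right (hL _ ⟨⟨by positivity, ?_⟩, hy0.le, hy.2⟩)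
        (by positivity)
      exact (div_le_one hy0).2 hy.1.le
    · refine (intervalIntegral.intervalIntegrable_inv (fun y hy => ?_) continuousOn_id).const_mul L
      rw [uIcc_of_le hxC] at hy
      exact (hx.trans_le hy.1).ne'
  rw [intervalIntegral.integral_const_mul, integral_inv_of_pos hx (hx.trans_le hxC),
    Real.log_div (hx.trans_le hxC).ne' hx.ne'] at hI
  rw [h x hx hx1]
  have h1 := norm_add_le (S x) (∫ y in x..C, (y : ℂ)⁻¹ * R (x / y, y))
  have h2 := hM x ⟨hx.le, hx1⟩
  have h3 : L * (Real.log C - Real.log x) ≤ L * ((1 + Real.log C) * (1 + |Real.log x|)) := by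
    refine mul_le_mul_of_nonneg_left ?_ hL0
    nlinarith [neg_abs_le (Real.log x), abs_nonneg (Real.log x)]
  nlinarith [mul_nonneg hM0 (abs_nonneg (Real.log x))]

theorem IsSmoothAddCornerIntegral.exists_step {C : ℝ} (hC : 1 ≤ C) {f : ℝ → ℂ}
    (hf : IsSmoothAddCornerIntegral C f) :
    ∃ (a b : ℂ) (g : ℝ → ℂ), IsSmoothAddCornerIntegral C g ∧
      ∀ x : ℝ, 0 < x → x ≤ 1 → f x = a + b * (Real.log x : ℂ) + x * g x := by
  obtain ⟨S, R, hS, hR, h⟩ := hf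
  obtain ⟨G, hG, hRG⟩ := exists_contDiff_eq_add_fst_mul hR
  obtain ⟨Q, hQ, hGQ⟩ := exists_contDiff_eq_add_snd_mul hG
  obtain ⟨B, hB, hRB⟩ := exists_contDiff_eq_add_mul
    (hR.comp (by fun_prop) : ContDiff ℝ ∞ fun y : ℝ => R (0, y))
  obtain ⟨P, hP, hPA⟩ := exists_contDiff_primitive
    (hG.comp (by fun_prop) : ContDiff ℝ ∞ fun s : ℝ => G (s, 0))
  obtain ⟨W, hW, hWB⟩ := exists_contDiff_primitive hB
  have hS' : ContDiff ℝ ∞ fun x : ℝ =>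
      S x + R (0, 0) * (Real.log C : ℂ) + P 1 - P (x / C) + W C - W x := by
    have : ContDiff ℝ ∞ fun x : ℝ => P (x / C) := hP.comp (by fun_prop)
    fun_prop
  obtain ⟨T, hT, hST⟩ := exists_contDiff_eq_add_mul hS'
  simp only [zero_div] at hST
  simp only [Function.comp_apply] at hRB hPA
  refine ⟨S 0 + R (0, 0) * (Real.log C : ℂ) + P 1 - P 0 + W C - W 0, -R (0, 0), _, ⟨T, Q, hT, hQ, fun x _ _ => rfl⟩, fun x hx hx1 => ?_⟩
  have hxC : x ≤ C := hx1.trans hC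
  have hpos : ∀ y ∈ uIcc x C, 0 < y := fun y hy => by
    rw [uIcc_of_le hxC] at hy
    exact hx.trans_le hy.1
  have hint {K : ℝ × ℝ → ℂ} (hK : ContDiff ℝ ∞ K) :
      IntervalIntegrable (fun y : ℝ => (y : ℂ)⁻¹ * K (x / y, y)) volume x C :=
    ContinuousOn.intervalIntegrable (by
      rw [uIcc_of_le hxC]
      exact continuousOn_corner_integrand hx hK.continuous)
  have hderiv : ∀ y ∈ uIcc x C, HasDerivAt
      (fun y : ℝ => R (0, 0) * (Real.log y : ℂ) - P (x / y) + W y)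
      ((y : ℂ)⁻¹ * R (x / y, y) - x * ((y : ℂ)⁻¹ * Q (x / y, y))) y := by
    intro y hy
    have hy0 : y ≠ 0 := (hpos y hy).ne'
    have h1 := (Real.hasDerivAt_log hy0).ofReal_comp.const_mul (R (0, 0))
    have hdiv : HasDerivAt (fun y : ℝ => x / y) (-x / y ^ 2) y :=
      ((hasDerivAt_const y x).fun_div (hasDerivAt_id' y) hy0).congr_deriv (by simp)
    have h2 := (hPA (x / y)).scomp y hdiv
    refine ((h1.sub h2).add (hWB y)).congr_deriv ?_
    rw [hRG (x / y) y, hGQ (x / y) y, hRB y, Complex.real_smul]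
    have : (y : ℂ) ≠ 0 := by exact_mod_cast hy0
    push_cast
    field_simp
    ring
  have hftc := intervalIntegral.integral_eq_sub_of_hasDerivAt hderiv
    ((hint hR).sub ((hint hQ).const_mul (x : ℂ)))
  rw [intervalIntegral.integral_sub (hint hR) ((hint hQ).const_mul (x : ℂ)),
    intervalIntegral.integral_const_mul, div_self hx.ne'] at hftc
  rw [h x hx hx1]
  linear_combination hftc + hST x

theorem IsSmoothAddCornerIntegral.exists_expansion {C : ℝ} (hC : 1 ≤ C) {f : ℝ → ℂ}
    (hf : IsSmoothAddCornerIntegral C f) :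
    ∃ a b : ℕ → ℂ, ∀ N : ℕ, ∃ CN : ℝ, ∀ x : ℝ, 0 < x → x ≤ 1 →
      ‖f x - ∑ i ∈ Finset.range N,
        (a i * (x : ℂ) ^ i + b i * (x : ℂ) ^ i * (Real.log x : ℂ))‖ ≤
        CN * x ^ N * (1 + |Real.log x|) := by
  choose a b g hg hstep using
    fun F : {F : ℝ → ℂ // IsSmoothAddCornerIntegral C F} => F.2.exists_step hC
  let st : ℕ → {F : ℝ → ℂ // IsSmoothAddCornerIntegral C F} :=
    fun n => (fun F => ⟨g F, hg F⟩)^[n] ⟨f, hf⟩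
  have hst (n : ℕ) : (st (n + 1)).1 = g (st n) := by
    simp only [st, Function.iterate_succ_apply']
  refine ⟨fun n => a (st n), fun n => b (st n), fun N => ?_⟩
  obtain ⟨K, hK⟩ := (st N).2.exists_bound hC
  refine ⟨K, fun x hx hx1 => ?_⟩
  have key (n : ℕ) : f x - ∑ i ∈ Finset.range n,
      (a (st i) * (x : ℂ) ^ i + b (st i) * (x : ℂ) ^ i * (Real.log x : ℂ)) =
        (x : ℂ) ^ n * (st n).1 x := by
    induction n with
    | zero => simp [st]
    | succ n ih =>
      rw [Finset.sum_range_succ, hst]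
      linear_combination ih + (x : ℂ) ^ n * hstep (st n) x hx hx1
  rw [key, norm_mul, norm_pow, Complex.norm_real, Real.norm_of_nonneg hx.le]
  calc x ^ N * ‖(st N).1 x‖ ≤ x ^ N * (K * (1 + |Real.log x|)) := by
        gcongr
        exact hK x hx hx1
    _ = K * x ^ N * (1 + |Real.log x|) := by ring

/-- The push-forward of a function resolved by the blow-up of the corner, split along the
diagonal. -/
theorem isSmoothAddCornerIntegral_pushforward {C : ℝ} (hC : 1 ≤ C) {u : ℝ × ℝ → ℂ}
    (hsupp : ∀ x y : ℝ, 0 < x → 0 < y → C < y → u (x, y) = 0)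
    {w₁ w₂ : ℝ × ℝ → ℂ} (hw₁ : ContDiff ℝ ∞ w₁) (hw₂ : ContDiff ℝ ∞ w₂)
    (h₁ : ∀ ξ η : ℝ, 0 < ξ → 0 < η → w₁ (ξ, η) = u (ξ, ξ * η))
    (h₂ : ∀ ξ η : ℝ, 0 < ξ → 0 < η → w₂ (ξ, η) = u (ξ * η, η)) :
    IsSmoothAddCornerIntegral C fun x => ∫ y in Ioi (0 : ℝ), u (x, y) := by
  have hR : ContDiff ℝ ∞ fun p : ℝ × ℝ => (p.2 : ℂ) * w₂ p :=
    (Complex.ofRealCLM.contDiff.comp contDiff_snd).mul hw₂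
  refine ⟨fun x => (x : ℂ) * ∫ t in (0 : ℝ)..1, w₁ (x, t), _,
    Complex.ofRealCLM.contDiff.mul (contDiff_infty_intervalIntegral 0 1 hw₁), hR,
    fun x hx hx1 => ?_⟩
  have hxC : x ≤ C := hx1.trans hC
  have e₁ : EqOn (fun y => u (x, y)) (fun y => w₁ (x, y / x)) (Ioc 0 x) := fun y hy => by
    simp only
    rw [h₁ _ _ hx (div_pos hy.1 hx), mul_div_cancel₀ _ hx.ne']
  have e₂ : EqOn (fun y => u (x, y)) (fun y : ℝ => (y : ℂ)⁻¹ * ((y : ℂ) * w₂ (x / y, y)))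
      (Ioc x C) := fun y hy => by
    have hy0 : 0 < y := hx.trans hy.1
    have : (y : ℂ) ≠ 0 := by exact_mod_cast hy0.ne'
    simp only
    rw [inv_mul_cancel_left₀ this, h₂ _ _ (div_pos hx hy0) hy0, div_mul_cancel₀ _ hy0.ne']
  have e₃ : EqOn (fun y => u (x, y)) (fun _ => 0) (Ioi C) := fun y hy =>
    hsupp x y hx (hx.trans_le (hxC.trans (le_of_lt hy))) hy
  have i₁ : IntegrableOn (fun y => u (x, y)) (Ioc 0 x) := by
    refine IntegrableOn.congr_fun ?_ e₁.symm measurableSet_Ioc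
    exact (hw₁.continuous.comp (by fun_prop :
      Continuous fun y : ℝ => (x, y / x))).integrableOn_Ioc
  have i₂ : IntegrableOn (fun y => u (x, y)) (Ioc x C) := by
    refine IntegrableOn.congr_fun ?_ e₂.symm measurableSet_Ioc
    exact (continuousOn_corner_integrand hx hR.continuous).integrableOn_Icc.mono_set
      Ioc_subset_Icc_self
  have i₃ : IntegrableOn (fun y => u (x, y)) (Ioi C) :=
    IntegrableOn.congr_fun integrableOn_zero e₃.symm measurableSet_Ioi
  beta_reduce
  rw [← Ioc_union_Ioi_eq_Ioi hx.le, setIntegral_union (Ioc_disjoint_Ioi le_rfl)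
    measurableSet_Ioi i₁ (by rw [← Ioc_union_Ioi_eq_Ioi hxC]; exact i₂.union i₃),
    ← Ioc_union_Ioi_eq_Ioi hxC, setIntegral_union (Ioc_disjoint_Ioi le_rfl)
    measurableSet_Ioi i₂ i₃, setIntegral_congr_fun measurableSet_Ioc e₁,
    setIntegral_congr_fun measurableSet_Ioc e₂, setIntegral_congr_fun measurableSet_Ioi e₃,
    ← intervalIntegral.integral_of_le hx.le, ← intervalIntegral.integral_of_le hxC,
    intervalIntegral.integral_comp_div (fun t => w₁ (x, t)) hx.ne', zero_div, div_self hx.ne']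
  simp

/-- **Push-forward of a function resolved by the corner blow-up is polyhomogeneous.**
Let `u` be a function on `(0,∞)²` supported in `{x ≤ C, y ≤ C}` which is resolved by the
blow-up of the corner: in both systems of projective coordinates, `u` extends to a
function smooth up to the boundary. Then `ũ(x) = ∫_0^∞ u(x,y) dy` has a complete
asymptotic expansion as `x → 0⁺` in powers `x^i` and terms `x^i log x`. -/
theorem pushforward_of_resolved_is_phg
    (C : ℝ) (hC : 0 < C) (u : ℝ × ℝ → ℂ)
    (hsupp : ∀ x y : ℝ, 0 < x → 0 < y → (C < x ∨ C < y) → u (x, y) = 0)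
    (w₁ w₂ : ℝ × ℝ → ℂ)
    (hw₁ : ContDiff ℝ (⊤ : ℕ∞) w₁) (hw₂ : ContDiff ℝ (⊤ : ℕ∞) w₂)
    (h₁ : ∀ ξ η : ℝ, 0 < ξ → 0 < η → w₁ (ξ, η) = u (ξ, ξ * η))
    (h₂ : ∀ ξ η : ℝ, 0 < ξ → 0 < η → w₂ (ξ, η) = u (ξ * η, η)) :
    ∃ a b : ℕ → ℂ, ∀ N : ℕ, ∃ CN : ℝ, ∀ x : ℝ, 0 < x → x ≤ 1 →
      ‖(∫ y in Set.Ioi (0 : ℝ), u (x, y)) -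
          ∑ i ∈ Finset.range N,
            (a i * (x : ℂ) ^ i + b i * (x : ℂ) ^ i * (Real.log x : ℂ))‖ ≤
        CN * x ^ N * (1 + |Real.log x|) :=
  (isSmoothAddCornerIntegral_pushforward (le_max_right C 1)
    (fun x y hx hy h => hsupp x y hx hy (Or.inr ((le_max_left C 1).trans_lt h)))
    hw₁ hw₂ h₁ h₂).exists_expansion (le_max_right C 1)
end
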